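/- In M_q(n), if L and L' are column index sets of the same cardinality m differing by the interchange of a single label, then the quantum minors D^K_L and D^K_{L'} q-commute: D^K_L D^K_{L'} = q^{±1} D^K_{L'} D^K_L (with sign of the exponent determined by the order of the interchanged labels). -/

import Mathlib

open scoped BigOperators

/-- The defining relations of the quantum matrix bialgebra `M_q(n)`. -/
inductive QMatRel (k : Type*) [Field k] (q : k) (n : ℕ) :
    FreeAlgebra k (Fin n × Fin n) → FreeAlgebra k (Fin n × Fin n) → Prop
  | row (a : Fin n) {c d : Fin n} (h : c < d) :
      QMatRel k q n (FreeAlgebra.ι k (a, c) * FreeAlgebra.ι k (a, d))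
        (q • (FreeAlgebra.ι k (a, d) * FreeAlgebra.ι k (a, c)))
  | col {a b : Fin n} (c : Fin n) (h : a < b) :
      QMatRel k q n (FreeAlgebra.ι k (a, c) * FreeAlgebra.ι k (b, c))
        (q • (FreeAlgebra.ι k (b, c) * FreeAlgebra.ι k (a, c)))
  | cross1 {a b c d : Fin n} (hab : a < b) (hcd : c < d) :
      QMatRel k q n (FreeAlgebra.ι k (a, c) * FreeAlgebra.ι k (b, d))
        (FreeAlgebra.ι k (b, d) * FreeAlgebra.ι k (a, c) +
          (q - q⁻¹) • (FreeAlgebra.ι k (b, c) * FreeAlgebra.ι k (a, d)))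
  | cross2 {a b c d : Fin n} (hab : a < b) (hdc : d < c) :
      QMatRel k q n (FreeAlgebra.ι k (a, c) * FreeAlgebra.ι k (b, d))
        (FreeAlgebra.ι k (b, d) * FreeAlgebra.ι k (a, c))

/-- The quantum matrix algebra `M_q(n)`. -/
abbrev QMat (k : Type*) [Field k] (q : k) (n : ℕ) : Type _ := RingQuot (QMatRel k q n)

/-- The generator `t^i_j` of `M_q(n)`. -/
noncomputable def tgen {k : Type*} [Field k] (q : k) (n : ℕ) (i j : Fin n) : QMat k q n :=
  RingQuot.mkAlgHom k (QMatRel k q n) (FreeAlgebra.ι k (i, j))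

/-- Number of inversions of a permutation of `Fin m`. -/
def invCount {m : ℕ} (σ : Equiv.Perm (Fin m)) : ℕ :=
  (Finset.univ.filter (fun p : Fin m × Fin m => p.1 < p.2 ∧ σ p.2 < σ p.1)).card

/-- The quantum minor `D^K_L` with row set `K` and column set `L` (both of
cardinality `m`, taken in increasing order). -/
noncomputable def qMinor {k : Type*} [Field k] (q : k) {n : ℕ} (m : ℕ)
    (K L : Finset (Fin n)) (hK : K.card = m) (hL : L.card = m) : QMat k q n :=
  ∑ σ : Equiv.Perm (Fin m), ((-q) ^ invCount σ) •
    (List.ofFn (fun i : Fin m =>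
      tgen q n (K.orderIsoOfFin hK i) (L.orderIsoOfFin hL (σ i)))).prod

open Finset

section Step

variable {k ι A : Type*} [Field k] [DecidableEq ι] [AddCommGroup A] [Module k A]

/-- Multiplication by `∑ s, x s ⊗ e s` on functions on finsets, viewed as elements of a quantum
exterior algebra with basis indexed by finsets. -/
noncomputable def wedgeStep (w : k) (r : ι → ι → Prop) [DecidableRel r]
    (x : ι → Module.End k A) : Module.End k (Finset ι → A) :=
  LinearMap.pi fun J => ∑ s ∈ J, w ^ #{j ∈ J | r j s} • (x s ∘ₗ LinearMap.proj (J.erase s))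

variable (w : k) (r : ι → ι → Prop) [DecidableRel r]

theorem wedgeStep_apply (x : ι → Module.End k A) (φ : Finset ι → A) (J : Finset ι) :
    wedgeStep w r x φ J = ∑ s ∈ J, w ^ #{j ∈ J | r j s} • x s (φ (J.erase s)) := by
  simp [wedgeStep]

theorem sum_sum_erase_eq_sum_pairs [IsStrictTotalOrder ι r] (J : Finset ι) (f : ι → ι → A) :
    ∑ s ∈ J, ∑ u ∈ J.erase s, f s u = ∑ s ∈ J, ∑ u ∈ J with r s u, (f s u + f u s) := by
  have split : ∀ s ∈ J, ∑ u ∈ J.erase s, f s u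
      = (∑ u ∈ J, if r s u then f s u else 0) + ∑ u ∈ J, if r u s then f s u else 0 := by
    intro s hs
    rw [← sum_add_distrib, ← add_sum_erase J _ hs]
    simp only [irrefl_of r s, if_false, add_zero, zero_add]
    refine sum_congr rfl fun u hu => ?_
    rcases trichotomous_of r s u with h | h | h
    · simp [h, asymm_of r h]
    · exact absurd h.symm (ne_of_mem_erase hu)
    · simp [h, asymm_of r h]
  rw [sum_congr rfl split, sum_add_distrib, sum_comm (f := fun s u => if r u s then f s u else 0),
    ← sum_add_distrib]
  refine sum_congr rfl fun s _ => ?_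
  rw [sum_filter, ← sum_add_distrib]
  exact sum_congr rfl fun u _ => by split_ifs <;> simp

theorem wedgeStep_wedgeStep_apply [IsStrictTotalOrder ι r] (x y : ι → Module.End k A)
    (φ : Finset ι → A) (J : Finset ι) :
    wedgeStep w r x (wedgeStep w r y φ) J = ∑ s ∈ J, ∑ u ∈ J with r s u,
      w ^ (#{j ∈ J | r j s} + #{j ∈ J.erase s | r j u}) •
        (x s * y u + w • (x u * y s)) (φ ((J.erase s).erase u)) := by
  simp only [wedgeStep_apply, map_sum, smul_sum, map_smul, smul_smul, ← pow_add]
  rw [sum_sum_erase_eq_sum_pairs r]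
  refine sum_congr rfl fun s hs => sum_congr rfl fun u hu => ?_
  obtain ⟨-, hsu⟩ := mem_filter.1 hu
  have h1 : #{j ∈ J | r j u} = #{j ∈ J.erase s | r j u} + 1 := by
    rw [filter_erase, card_erase_add_one (by simp [hs, hsu])]
  have h2 : #{j ∈ J.erase u | r j s} = #{j ∈ J | r j s} := by
    rw [filter_erase, erase_eq_of_notMem (by simp [asymm_of r hsu])]
  rw [h1, h2, erase_right_comm (a := u)]
  simp only [LinearMap.add_apply, LinearMap.smul_apply, Module.End.mul_apply, smul_add, smul_smul]
  congr 2
  ring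

theorem wedgeStep_mul_wedgeStep [IsStrictTotalOrder ι r] (x y : ι → Module.End k A) (c : k)
    (h : ∀ s u, r s u → x s * y u + w • (x u * y s) = c • (y s * x u + w • (y u * x s))) :
    wedgeStep w r x * wedgeStep w r y = c • (wedgeStep w r y * wedgeStep w r x) := by
  ext φ J
  simp only [LinearMap.smul_apply, Module.End.mul_apply, Pi.smul_apply]
  rw [wedgeStep_wedgeStep_apply, wedgeStep_wedgeStep_apply, smul_sum]
  refine sum_congr rfl fun s _ => ?_
  rw [smul_sum]
  refine sum_congr rfl fun u hu => ?_
  rw [h s u (mem_filter.1 hu).2, LinearMap.smul_apply, smul_comm]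

end Step

section Words

variable {k ι B : Type*} [Field k] [Ring B] [Algebra k B]

theorem mul_prod_map_eq_zero_of_mem (X : ι → B)
    (hsq : ∀ a, X a * X a = 0) (hcomm : ∀ a b, a ≠ b → ∃ c : k, X a * X b = c • (X b * X a))
    {a : ι} {l : List ι} (ha : a ∈ l) : X a * (l.map X).prod = 0 := by
  induction l with
  | nil => simp at ha
  | cons b l ih =>
    rw [List.map_cons, List.prod_cons, ← mul_assoc]
    by_cases hab : a = b
    · rw [← hab, hsq, zero_mul]
    · obtain ⟨c, hc⟩ := hcomm a b hab
      rw [hc, smul_mul_assoc, mul_assoc, ih (by simpa [hab] using ha), mul_zero, smul_zero]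

theorem mul_prod_map_eq_orderedInsert [LinearOrder ι] (X : ι → B) (w : k)
    (hcomm : ∀ a b, a < b → X a * X b = w • (X b * X a))
    (a : ι) (l : List ι) (hl : l.Pairwise (· ≥ ·)) :
    X a * (l.map X).prod
      = w ^ l.countP (a < ·) • ((l.orderedInsert (· ≥ ·) a).map X).prod := by
  induction l with
  | nil => simp
  | cons b l ih =>
    rw [List.pairwise_cons] at hl
    by_cases hab : a ≥ b
    · have h0 : (b :: l).countP (a < ·) = 0 := by
        rw [List.countP_eq_zero]
        intro c hc
        rcases List.mem_cons.1 hc with rfl | hc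
        · simpa using hab
        · simpa using (hl.1 c hc).trans hab
      rw [List.orderedInsert_cons, if_pos hab, h0]
      simp
    · rw [List.orderedInsert_cons, if_neg hab, List.map_cons, List.prod_cons, ← mul_assoc,
        hcomm a b (not_le.1 hab), smul_mul_assoc, mul_assoc, ih hl.2, mul_smul_comm, smul_smul,
        List.countP_cons_of_pos (by simpa using hab), pow_succ', List.map_cons, List.prod_cons]

end Words

section Laplace

theorem invCount_eq_sum {m : ℕ} (σ : Equiv.Perm (Fin m)) :
    invCount σ = ∑ i, ∑ j, if i < j ∧ σ j < σ i then 1 else 0 := by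
  rw [invCount, card_filter, ← univ_product_univ, sum_product]

/-- The permutation with `0 ↦ p` whose remaining values are arranged according to `τ`. -/
def permCons {m : ℕ} (p : Fin (m + 1)) (τ : Equiv.Perm (Fin m)) : Equiv.Perm (Fin (m + 1)) :=
  p.cycleRange.symm * Equiv.Perm.decomposeFin.symm (0, τ)

@[simp]
theorem permCons_zero {m : ℕ} (p : Fin (m + 1)) (τ : Equiv.Perm (Fin m)) :
    permCons p τ 0 = p := by
  simp [permCons]

@[simp]
theorem permCons_succ {m : ℕ} (p : Fin (m + 1)) (τ : Equiv.Perm (Fin m)) (i : Fin m) :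
    permCons p τ i.succ = p.succAbove (τ i) := by
  simp [permCons]

theorem permCons_bijective (m : ℕ) :
    Function.Bijective fun x : Fin (m + 1) × Equiv.Perm (Fin m) => permCons x.1 x.2 := by
  rw [Fintype.bijective_iff_injective_and_card]
  constructor
  · rintro ⟨p, τ⟩ ⟨p', τ'⟩ h
    have h0 : p = p' := by simpa using DFunLike.congr_fun h 0
    subst h0
    have h1 : τ = τ' := by
      ext i : 1
      simpa using DFunLike.congr_fun h i.succ
    rw [h1]
  · simp [Fintype.card_perm, Nat.factorial_succ]

theorem invCount_permCons {m : ℕ} (p : Fin (m + 1)) (τ : Equiv.Perm (Fin m)) :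
    invCount (permCons p τ) = p + invCount τ := by
  have h : ∑ j, (if p.succAbove (τ j) < p then 1 else 0) = (p : ℕ) := by
    rw [Equiv.sum_comp τ fun j => if p.succAbove j < p then 1 else 0, ← card_filter]
    simp only [Fin.succAbove_lt_iff_castSucc_lt]
    simp only [Fin.lt_def, Fin.val_castSucc]
    rw [Fin.card_filter_val_lt]
    omega
  simp only [invCount_eq_sum, Fin.sum_univ_succ, permCons_zero, permCons_succ,
    (Fin.strictMono_succAbove p).lt_iff_lt, Fin.succ_lt_succ_iff, Fin.succ_pos, true_and, h]
  simp

variable {k A : Type*} [Field k] [Ring A] [Algebra k A]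

theorem sum_perm_succ (w : k) {m : ℕ} (g : Fin (m + 1) → Fin (m + 1) → A) :
    ∑ σ : Equiv.Perm (Fin (m + 1)), w ^ invCount σ • (List.ofFn fun i => g i (σ i)).prod
      = ∑ p : Fin (m + 1), w ^ (p : ℕ) • (g 0 p * ∑ τ : Equiv.Perm (Fin m),
          w ^ invCount τ • (List.ofFn fun i => g i.succ (p.succAbove (τ i))).prod) := by
  rw [← (permCons_bijective m).sum_comp, Fintype.sum_prod_type]
  refine sum_congr rfl fun p _ => ?_
  rw [mul_sum, smul_sum]
  refine sum_congr rfl fun τ _ => ?_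
  simp [List.ofFn_succ, invCount_permCons, pow_add, smul_smul]

end Laplace

section Minors

variable {k : Type*} [Field k] {q : k} {n : ℕ}

theorem tgen_row (i : Fin n) {c d : Fin n} (h : c < d) :
    tgen q n i c * tgen q n i d = q • (tgen q n i d * tgen q n i c) := by
  simpa [tgen] using RingQuot.mkAlgHom_rel k (QMatRel.row (k := k) (q := q) i h)

theorem tgen_col {i j : Fin n} (c : Fin n) (h : i < j) :
    tgen q n i c * tgen q n j c = q • (tgen q n j c * tgen q n i c) := by
  simpa [tgen] using RingQuot.mkAlgHom_rel k (QMatRel.col (k := k) (q := q) c h)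

theorem tgen_cross {i j c d : Fin n} (hij : i < j) (hcd : c < d) :
    tgen q n i c * tgen q n j d = tgen q n j d * tgen q n i c +
      (q - q⁻¹) • (tgen q n j c * tgen q n i d) := by
  simpa [tgen] using RingQuot.mkAlgHom_rel k (QMatRel.cross1 (k := k) (q := q) hij hcd)

theorem tgen_commute {i j c d : Fin n} (hij : i < j) (hdc : d < c) :
    tgen q n i c * tgen q n j d = tgen q n j d * tgen q n i c := by
  simpa [tgen] using RingQuot.mkAlgHom_rel k (QMatRel.cross2 (k := k) (q := q) hij hdc)

variable (q)

/-- Multiplication by the `i`-th row of the generic quantum matrix. -/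
noncomputable def rowStep (i : Fin n) : Module.End k (Finset (Fin n) → QMat k q n) :=
  wedgeStep (-q) (· < ·) fun s => LinearMap.mulLeft k (tgen q n i s)

/-- Multiplication by the `c`-th column of the generic quantum matrix. -/
noncomputable def colStep (c : Fin n) : Module.End k (Finset (Fin n) → QMat k q n) :=
  wedgeStep (-q) (· > ·) fun i => LinearMap.mulRight k (tgen q n i c)

theorem rowStep_apply (i : Fin n) (φ : Finset (Fin n) → QMat k q n) (J : Finset (Fin n)) :
    rowStep q i φ J = ∑ s ∈ J, (-q) ^ #{j ∈ J | j < s} • (tgen q n i s * φ (J.erase s)) := by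
  simp [rowStep, wedgeStep_apply]

theorem colStep_apply (c : Fin n) (φ : Finset (Fin n) → QMat k q n) (I : Finset (Fin n)) :
    colStep q c φ I = ∑ i ∈ I, (-q) ^ #{j ∈ I | j > i} • (φ (I.erase i) * tgen q n i c) := by
  simp [colStep, wedgeStep_apply]

theorem rowStep_mul_self (i : Fin n) : rowStep q i * rowStep q i = 0 := by
  have := wedgeStep_mul_wedgeStep (-q) (· < ·) (fun s => LinearMap.mulLeft k (tgen q n i s))
    (fun s => LinearMap.mulLeft k (tgen q n i s)) 0 fun s u hsu => by
      ext z
      simp [← mul_assoc, tgen_row i hsu]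
  simpa [rowStep] using this

theorem colStep_mul_self (c : Fin n) : colStep q c * colStep q c = 0 := by
  have := wedgeStep_mul_wedgeStep (-q) (· > ·) (fun i => LinearMap.mulRight k (tgen q n i c))
    (fun i => LinearMap.mulRight k (tgen q n i c)) 0 fun s u hsu => by
      ext z
      simp [mul_assoc, tgen_col c hsu]
  simpa [colStep] using this

variable {q}

theorem rowStep_mul_rowStep (hq : q ≠ 0) {i j : Fin n} (hij : i < j) :
    rowStep q j * rowStep q i = (-q) • (rowStep q i * rowStep q j) := by
  refine wedgeStep_mul_wedgeStep _ _ _ _ _ fun s u hsu => ?_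
  ext z
  simp only [LinearMap.add_apply, LinearMap.smul_apply, Module.End.mul_apply,
    LinearMap.mulLeft_apply, ← mul_assoc, tgen_cross hij hsu, tgen_commute hij hsu, add_mul,
    smul_mul_assoc]
  match_scalars
  all_goals field_simp
  ring

theorem colStep_mul_colStep (hq : q ≠ 0) {c d : Fin n} (hcd : c < d) :
    colStep q c * colStep q d = (-q) • (colStep q d * colStep q c) := by
  refine wedgeStep_mul_wedgeStep _ _ _ _ _ fun s u hsu => ?_
  ext z
  simp only [LinearMap.add_apply, LinearMap.smul_apply, Module.End.mul_apply,
    LinearMap.mulRight_apply, mul_assoc, tgen_cross hsu hcd, tgen_commute hsu hcd, mul_add,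
    mul_smul_comm]
  match_scalars
  all_goals field_simp
  ring

theorem exists_rowStep_mul_rowStep (hq : q ≠ 0) {i j : Fin n} (hij : i ≠ j) :
    ∃ c : k, rowStep q i * rowStep q j = c • (rowStep q j * rowStep q i) := by
  rcases hij.lt_or_gt with h | h
  · exact ⟨(-q)⁻¹, by rw [rowStep_mul_rowStep hq h, inv_smul_smul₀ (neg_ne_zero.2 hq)]⟩
  · exact ⟨_, rowStep_mul_rowStep hq h⟩

theorem exists_colStep_mul_colStep (hq : q ≠ 0) {c d : Fin n} (hcd : c ≠ d) :
    ∃ x : k, colStep q c * colStep q d = x • (colStep q d * colStep q c) := by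
  rcases hcd.lt_or_gt with h | h
  · exact ⟨_, colStep_mul_colStep hq h⟩
  · exact ⟨(-q)⁻¹, by rw [colStep_mul_colStep hq h, inv_smul_smul₀ (neg_ne_zero.2 hq)]⟩

variable (q)

/-- The quantum minors with rows `K`, computed by successive expansion along the first row. -/
noncomputable def rowMinor (K : Finset (Fin n)) : Finset (Fin n) → QMat k q n :=
  ((K.sort (· ≤ ·)).map (rowStep q)).prod (Pi.single ∅ 1)

/-- The quantum minors with columns `L`, computed by successive expansion along the last
column. -/
noncomputable def colMinor (L : Finset (Fin n)) : Finset (Fin n) → QMat k q n :=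
  ((L.sort (· ≥ ·)).map (colStep q)).prod (Pi.single ∅ 1)

theorem prod_rowStep_ofFn_apply {m : ℕ} (f : Fin m → Fin n) (L : Finset (Fin n))
    (hL : #L = m) :
    ((List.ofFn f).map (rowStep q)).prod (Pi.single ∅ 1) L =
      ∑ σ : Equiv.Perm (Fin m), (-q) ^ invCount σ •
        (List.ofFn fun i => tgen q n (f i) (L.orderEmbOfFin hL (σ i))).prod := by
  induction m generalizing L with
  | zero =>
    rw [card_eq_zero] at hL
    subst hL
    simp [invCount]
  | succ m ih =>
    rw [sum_perm_succ (-q) fun i j => tgen q n (f i) (L.orderEmbOfFin hL j), List.ofFn_succ,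
      List.map_cons, List.prod_cons, Module.End.mul_apply, rowStep_apply]
    conv_lhs => rw [← image_orderEmbOfFin_univ L hL]
    rw [sum_image (L.orderEmbOfFin hL).injective.injOn]
    refine sum_congr rfl fun p _ => ?_
    rw [image_orderEmbOfFin_univ L hL]
    have hp : L.orderEmbOfFin hL p ∈ L := orderEmbOfFin_mem L hL p
    have hcard : #(L.erase (L.orderEmbOfFin hL p)) = m := by
      rw [card_erase_of_mem hp, hL, Nat.add_sub_cancel]
    have hcount : #{j ∈ L | j < L.orderEmbOfFin hL p} = p := by
      have : {j ∈ L | j < L.orderEmbOfFin hL p} = (Iio p).image (L.orderEmbOfFin hL) := by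
        ext j
        rw [mem_filter, mem_image, ← mem_coe, ← range_orderEmbOfFin L hL]
        constructor
        · rintro ⟨⟨i, rfl⟩, hi⟩
          exact ⟨i, by simpa using hi, rfl⟩
        · rintro ⟨i, hi, rfl⟩
          exact ⟨⟨i, rfl⟩, by simpa using hi⟩
      rw [this, card_image_of_injective _ (L.orderEmbOfFin hL).injective, Fin.card_Iio]
    have hemb : ∀ j, (L.erase (L.orderEmbOfFin hL p)).orderEmbOfFin hcard j
        = L.orderEmbOfFin hL (p.succAbove j) := by
      intro j
      refine (congrFun (orderEmbOfFin_unique hcard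
        (f := fun j => L.orderEmbOfFin hL (p.succAbove j)) (fun j => ?_) ?_) j).symm
      · simp [p.succAbove_ne j]
      · exact (L.orderEmbOfFin hL).strictMono.comp p.strictMono_succAbove
    rw [hcount, ih _ _ hcard]
    simp only [hemb]

theorem qMinor_eq_rowMinor {m : ℕ} (K L : Finset (Fin n)) (hK : #K = m) (hL : #L = m) :
    qMinor q m K L hK hL = rowMinor q K L := by
  have hsort : K.sort (· ≤ ·) = List.ofFn (K.orderEmbOfFin hK) := by
    refine List.ext_getElem (by simp [hK]) fun i _ _ => ?_
    simp [orderEmbOfFin_apply]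
  rw [rowMinor, hsort, prod_rowStep_ofFn_apply q _ L hL]
  rfl

theorem rowMinor_insert {K : Finset (Fin n)} {i : Fin n} (hi : ∀ j ∈ K, i < j) :
    rowMinor q (insert i K) = rowStep q i (rowMinor q K) := by
  rw [rowMinor, sort_insert _ (fun j hj => (hi j hj).le) fun h => (hi i h).false]
  rfl

theorem colMinor_insert {L : Finset (Fin n)} {c : Fin n} (hc : ∀ d ∈ L, d < c) :
    colMinor q (insert c L) = colStep q c (colMinor q L) := by
  rw [colMinor, sort_insert _ (fun d hd => (hc d hd).le) fun h => (hc c h).false]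
  rfl

theorem commute_rowMinor {z : QMat k q n} (K L : Finset (Fin n))
    (h : ∀ i ∈ K, ∀ c ∈ L, Commute z (tgen q n i c)) : Commute z (rowMinor q K L) := by
  induction K using Finset.induction_on_min generalizing L with
  | empty =>
    by_cases hL : L = ∅
    · simp [rowMinor, hL]
    · simp [rowMinor, hL]
  | insert i K hi ih =>
    rw [rowMinor_insert q hi, rowStep_apply]
    refine Commute.sum_right _ _ _ fun s hs => Commute.smul_right (Commute.mul_right ?_ ?_) _
    · exact h i (mem_insert_self i K) s hs
    · exact ih _ fun j hj c hc => h j (mem_insert_of_mem hj) c (mem_of_mem_erase hc)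

theorem rowMinor_eq_colMinor (m : ℕ) (K L : Finset (Fin n)) (hK : #K = m) (hL : #L = m) :
    rowMinor q K L = colMinor q L K := by
  induction m using Nat.strong_induction_on generalizing K L with
  | _ m ih =>
    rcases Nat.eq_zero_or_pos m with rfl | hm
    · rw [card_eq_zero] at hK hL
      subst hK hL
      simp [rowMinor, colMinor]
    have hKne : K.Nonempty := card_pos.1 (by omega)
    have hLne : L.Nonempty := card_pos.1 (by omega)
    obtain ⟨i, K, hi, rfl⟩ : ∃ i K', (∀ j ∈ K', i < j) ∧ K = insert i K' :=
      ⟨K.min' hKne, K.erase (K.min' hKne), fun j hj => min'_lt_of_mem_erase_min' _ _ hj,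
        (insert_erase (min'_mem _ _)).symm⟩
    obtain ⟨c, L, hc, rfl⟩ : ∃ c L', (∀ d ∈ L', d < c) ∧ L = insert c L' :=
      ⟨L.max' hLne, L.erase (L.max' hLne), fun j hj => lt_max'_of_mem_erase_max' _ _ hj,
        (insert_erase (max'_mem _ _)).symm⟩
    have hiK : i ∉ K := fun h => (hi i h).false
    have hcL : c ∉ L := fun h => (hc c h).false
    rw [card_insert_of_notMem hiK] at hK
    rw [card_insert_of_notMem hcL] at hL
    have hrow (j) (hj : j ∈ K) : colMinor q L ((insert i K).erase j) =
        ∑ s ∈ L, (-q) ^ #{d ∈ L | d < s} •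
          (tgen q n i s * rowMinor q (K.erase j) (L.erase s)) := by
      have hji : i ≠ j := (hi j hj).ne
      rw [← ih (m - 1) (by omega) _ _ (by
        rw [card_erase_of_mem (mem_insert_of_mem hj), card_insert_of_notMem hiK]; omega)
        (by omega), erase_insert_of_ne hji,
        rowMinor_insert q fun l hl => hi l (mem_of_mem_erase hl), rowStep_apply]
    have hcol (s) (hs : s ∈ L) : rowMinor q K ((insert c L).erase s) =
        ∑ j ∈ K, (-q) ^ #{l ∈ K | l > j} •
          (rowMinor q (K.erase j) (L.erase s) * tgen q n j c) := by
      have hsc : c ≠ s := (hc s hs).ne'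
      rw [ih (m - 1) (by omega) _ _ (by omega) (by
        rw [card_erase_of_mem (mem_insert_of_mem hs), card_insert_of_notMem hcL]; omega),
        erase_insert_of_ne hsc,
        colMinor_insert q fun l hl => hc l (mem_of_mem_erase hl), colStep_apply]
      refine sum_congr rfl fun j hj => ?_
      rw [ih (m - 2) (by omega) _ _ (by rw [card_erase_of_mem hj]; omega)
        (by rw [card_erase_of_mem hs]; omega)]
    rw [rowMinor_insert q hi, colMinor_insert q hc, rowStep_apply, colStep_apply,
      sum_insert hcL, sum_insert hiK, erase_insert hcL, erase_insert hiK]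
    congr 1
    · have h1 : #{d ∈ insert c L | d < c} = #L := by
        rw [filter_insert, if_neg (lt_irrefl c), filter_true_of_mem hc]
      have h2 : #{j ∈ insert i K | j > i} = #K := by
        rw [filter_insert, if_neg (lt_irrefl i), filter_true_of_mem hi]
      rw [h1, h2, ← ih (m - 1) (by omega) K L (by omega) (by omega)]
      have hcomm : Commute (tgen q n i c) (rowMinor q K L) :=
        commute_rowMinor q K L fun j hj d hd => tgen_commute (hi j hj) (hc d hd)
      rw [hcomm.eq]
      congr 2
      omega
    · rw [sum_congr (s₁ := L) rfl fun s hs => by rw [hcol s hs],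
        sum_congr (s₁ := K) rfl fun j hj => by rw [hrow j hj]]
      simp only [mul_sum, sum_mul, smul_sum]
      rw [sum_comm]
      refine sum_congr rfl fun j hj => sum_congr rfl fun s hs => ?_
      have h1 : #{d ∈ insert c L | d < s} = #{d ∈ L | d < s} := by
        rw [filter_insert, if_neg (hc s hs).not_gt]
      have h2 : #{l ∈ insert i K | l > j} = #{l ∈ K | l > j} := by
        rw [filter_insert, if_neg (hi j hj).not_gt]
      rw [h1, h2]
      simp only [mul_smul_comm, smul_mul_assoc, smul_smul, mul_assoc]
      rw [mul_comm]

variable {q}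

theorem rowStep_rowMinor_of_mem (hq : q ≠ 0) {K : Finset (Fin n)} {i : Fin n} (hi : i ∈ K) :
    rowStep q i (rowMinor q K) = 0 := by
  rw [rowMinor, ← Module.End.mul_apply, mul_prod_map_eq_zero_of_mem (k := k) (rowStep q)
    (rowStep_mul_self q) (fun _ _ h => exists_rowStep_mul_rowStep hq h)
    ((mem_sort _).2 hi), LinearMap.zero_apply]

theorem colStep_colMinor_of_mem (hq : q ≠ 0) {L : Finset (Fin n)} {c : Fin n} (hc : c ∈ L) :
    colStep q c (colMinor q L) = 0 := by
  rw [colMinor, ← Module.End.mul_apply, mul_prod_map_eq_zero_of_mem (k := k) (colStep q)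
    (colStep_mul_self q) (fun _ _ h => exists_colStep_mul_colStep hq h)
    ((mem_sort _).2 hc), LinearMap.zero_apply]

theorem colStep_colMinor_of_notMem (hq : q ≠ 0) {L : Finset (Fin n)} {c : Fin n} (hc : c ∉ L) :
    colStep q c (colMinor q L) = (-q) ^ #{d ∈ L | c < d} • colMinor q (insert c L) := by
  have hperm : ((L.sort (· ≥ ·)).orderedInsert (· ≥ ·) c) = (insert c L).sort (· ≥ ·) := by
    refine List.Perm.eq_of_pairwise' (r := (· ≥ ·)) ((pairwise_sort L (· ≥ ·)).orderedInsert c _)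
      (pairwise_sort _ (· ≥ ·)) ?_
    refine (List.perm_orderedInsert _ c _).trans ?_
    rw [List.perm_ext_iff_of_nodup (by simp [hc]) (sort_nodup _ _)]
    simp
  have hcount : (L.sort (· ≥ ·)).countP (c < ·) = #{d ∈ L | c < d} := by
    rw [← Multiset.coe_countP, sort_eq, Multiset.countP_eq_card_filter]
    rfl
  rw [colMinor, ← Module.End.mul_apply, mul_prod_map_eq_orderedInsert (colStep q) (-q)
    (fun _ _ h => colStep_mul_colStep hq h) c _ (pairwise_sort L _), hperm, hcount]
  rfl

/-- A column-by-row expansion of `colStep` against the vanishing expansions of minors with a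
repeated row. -/
theorem sum_colStep_mul_rowMinor (hq : q ≠ 0) (K S : Finset (Fin n))
    (φ : Finset (Fin n) → QMat k q n) :
    ∑ s ∈ S, (-q) ^ #{j ∈ S | j < s} • (colStep q s φ K * rowMinor q K (S.erase s)) = 0 := by
  have key : ∀ i ∈ K, (-q) ^ #{j ∈ K | j > i} • (φ (K.erase i) *
      ∑ s ∈ S, (-q) ^ #{j ∈ S | j < s} • (tgen q n i s * rowMinor q K (S.erase s))) = 0 := by
    intro i hi
    rw [← rowStep_apply, rowStep_rowMinor_of_mem hq hi]
    simp
  rw [← sum_eq_zero key]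
  simp only [colStep_apply, sum_mul, mul_sum, smul_sum]
  rw [sum_comm]
  refine sum_congr rfl fun i _ => sum_congr rfl fun s _ => ?_
  simp only [mul_smul_comm, smul_mul_assoc, mul_assoc]
  rw [smul_comm]

theorem rowMinor_insert_qcommute (hq : q ≠ 0) {K C : Finset (Fin n)} {a b : Fin n}
    (hK : #K = #C + 1) (ha : a ∉ C) (hb : b ∉ C) (hab : a < b) :
    rowMinor q K (insert a C) * rowMinor q K (insert b C) =
      q • (rowMinor q K (insert b C) * rowMinor q K (insert a C)) := by
  have haS : a ∉ insert b C := by simp [ha, hab.ne]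
  have h := sum_colStep_mul_rowMinor hq K (insert a (insert b C)) (colMinor q C)
  have hCa : ∀ c ∉ C, colStep q c (colMinor q C) K
      = (-q) ^ #{d ∈ C | c < d} • rowMinor q K (insert c C) := by
    intro c hc
    rw [colStep_colMinor_of_notMem hq hc, Pi.smul_apply,
      rowMinor_eq_colMinor q _ K _ hK (card_insert_of_notMem hc)]
  rw [sum_insert haS, sum_insert hb, sum_eq_zero (s := C) fun s hs => by
    rw [colStep_colMinor_of_mem hq hs]; simp, hCa a ha, hCa b hb, erase_insert haS,
    insert_comm, erase_insert (by simp [hb, hab.ne']), add_zero] at h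
  have hcard : ∀ c ∉ C, #{j ∈ C | j < c} + #{j ∈ C | c < j} = #C := by
    intro c hc
    rw [← card_filter_add_card_filter_not (s := C) (· < c)]
    congr 2
    refine filter_congr fun j hj => ?_
    have : j ≠ c := fun e => hc (e ▸ hj)
    rw [not_lt]
    exact ⟨le_of_lt, fun hle => lt_of_le_of_ne hle this.symm⟩
  have h1 : #{j ∈ insert b (insert a C) | j < a} = #{j ∈ C | j < a} := by
    simp [filter_insert, hab.not_gt]
  have h2 : #{j ∈ insert b (insert a C) | j < b} = #{j ∈ C | j < b} + 1 := by
    simp [filter_insert, hab, ha]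
  rw [h1, h2, smul_mul_assoc, smul_mul_assoc, smul_smul, smul_smul, ← pow_add, ← pow_add,
    hcard a ha, add_right_comm, hcard b hb, pow_succ, mul_smul, ← smul_add,
    smul_eq_zero_iff_right (pow_ne_zero _ (neg_ne_zero.2 hq)), neg_smul, ← sub_eq_add_neg,
    sub_eq_zero] at h
  exact h

end Minors

/-- Lemma 3 (ii), last part: if `L` and `L'` differ by the interchange of a
single label, then the quantum minors `D^K_L` and `D^K_{L'}` `q^{±1}`-commute. -/
theorem qMinor_qMinor_qcommute {k : Type*} [Field k] (q : k) (hq : q ≠ 0)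
    {n : ℕ} (m : ℕ) (K L L' : Finset (Fin n)) (hK : K.card = m)
    (hL : L.card = m) (hL' : L'.card = m)
    (a b : Fin n) (ha : a ∈ L) (hb : b ∉ L) (hLL' : L' = insert b (L.erase a)) :
    ∃ ε : ℤ, (ε = 1 ∨ ε = -1) ∧
      qMinor q m K L hK hL * qMinor q m K L' hK hL' =
        q ^ ε • (qMinor q m K L' hK hL' * qMinor q m K L hK hL) := by
  have haC : a ∉ L.erase a := notMem_erase a L
  have hbC : b ∉ L.erase a := fun h => hb (mem_of_mem_erase h)
  have hcard : #K = #(L.erase a) + 1 := by rw [card_erase_add_one ha, hK, hL]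
  have hLe : rowMinor q K L = rowMinor q K (insert a (L.erase a)) := by rw [insert_erase ha]
  have hne : a ≠ b := fun h => hb (h ▸ ha)
  rw [qMinor_eq_rowMinor, qMinor_eq_rowMinor, hLe, hLL']
  rcases hne.lt_or_gt with hab | hab
  · refine ⟨1, Or.inl rfl, ?_⟩
    rw [zpow_one, rowMinor_insert_qcommute hq hcard haC hbC hab]
  · refine ⟨-1, Or.inr rfl, ?_⟩
    rw [zpow_neg_one, rowMinor_insert_qcommute hq hcard hbC haC hab, inv_smul_smul₀ hq]
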